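/- Let S be a semigroup, a₁,a₂,… a sequence in S, and A₁ ⊇ A₂ ⊇ ⋯ a free idempotent chain with Aₙ ⊆ FS(aₙ,aₙ₊₁,…) for all n. Then for each finite coloring of S and each finite coloring of [S]², there are elements b₁ ∈ A₁, b₂ ∈ A₂, … such that: (1) the sequence (bₙ) is a proper sumsequence of (aₙ); (2) the set FS(b₁,b₂,…) is monochromatic; (3) the sum graph of (bₙ) is monochromatic. -/

import Mathlib

/-- The sum `a_F = a_{i₁} + ⋯ + a_{i_k}` for `F = {i₁ < ⋯ < i_k}`,
summed in increasing order of indices (junk value `a 0` if `F = ∅`). -/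
def fsum {S : Type*} [AddSemigroup S] (a : ℕ → S) (F : Finset ℕ) : S :=
  match (F.sort (· ≤ ·)).map a with
  | [] => a 0
  | x :: xs => xs.foldl (· + ·) x

/-- `F < H` for finite sets of naturals: every element of `F` is below every element of `H`. -/
def FinsetLT (F H : Finset ℕ) : Prop := ∀ i ∈ F, ∀ j ∈ H, i < j

/-- A sequence is proper if `b_F ≠ b_H` for all nonempty finite `F < H`. -/
def IsProper {S : Type*} [AddSemigroup S] (b : ℕ → S) : Prop :=
  ∀ F H : Finset ℕ, F.Nonempty → H.Nonempty → FinsetLT F H → fsum b F ≠ fsum b H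

/-- `b` is a sumsequence of `a`: `b n = a_{Fₙ}` for nonempty finite sets `F₀ < F₁ < ⋯`. -/
def IsSumSeq {S : Type*} [AddSemigroup S] (a b : ℕ → S) : Prop :=
  ∃ F : ℕ → Finset ℕ, (∀ n, (F n).Nonempty) ∧ (∀ n, FinsetLT (F n) (F (n + 1))) ∧
    ∀ n, b n = fsum a (F n)

/-- The set of finite sums of the sequence `a`. -/
def FSset {S : Type*} [AddSemigroup S] (a : ℕ → S) : Set S :=
  {s | ∃ F : Finset ℕ, F.Nonempty ∧ fsum a F = s}

/-- The set of finite sums of the tail `aₙ, aₙ₊₁, …`. -/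
def FStail {S : Type*} [AddSemigroup S] (a : ℕ → S) (n : ℕ) : Set S :=
  {s | ∃ F : Finset ℕ, F.Nonempty ∧ (∀ i ∈ F, n ≤ i) ∧ fsum a F = s}

/-- `A⋆(ℱ) = {b : ∃ C ∈ ℱ, b + C ⊆ A}`. -/
def starSet {S : Type*} [Add S] (A : Set S) (ℱ : Set (Set S)) : Set S :=
  {b | ∃ C ∈ ℱ, ∀ c ∈ C, b + c ∈ A}

/-- A (proper) filter of subsets of `S`, as a family of sets. -/
def IsFilterFam {S : Type*} (ℱ : Set (Set S)) : Prop :=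
  Set.univ ∈ ℱ ∧ ∅ ∉ ℱ ∧ (∀ A ∈ ℱ, ∀ B : Set S, A ⊆ B → B ∈ ℱ) ∧
    ∀ A ∈ ℱ, ∀ B ∈ ℱ, A ∩ B ∈ ℱ

/-- A superfilter on `S`: a (nonempty) family of infinite sets, upward closed,
such that whenever a union of two sets belongs to it, one of them does. -/
def IsSuperfilter {S : Type*} (𝒜 : Set (Set S)) : Prop :=
  Set.univ ∈ 𝒜 ∧ (∀ A ∈ 𝒜, A.Infinite) ∧ (∀ A ∈ 𝒜, ∀ B : Set S, A ⊆ B → B ∈ 𝒜) ∧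
    ∀ A B : Set S, A ∪ B ∈ 𝒜 → A ∈ 𝒜 ∨ B ∈ 𝒜

/-- A free idempotent chain: a descending sequence of infinite sets with empty
intersection such that each `Aₙ⋆({A₁,A₂,…})` contains some `A_m`. -/
def IsFreeIdemChain {S : Type*} [AddSemigroup S] (A : ℕ → Set S) : Prop :=
  (∀ n, (A n).Infinite) ∧ (∀ n, A (n + 1) ⊆ A n) ∧ (⋂ n, A n) = ∅ ∧
    ∀ n, ∃ m, A m ⊆ starSet (A n) (Set.range A)

open Filter

attribute [local instance] Ultrafilter.add Ultrafilter.addSemigroup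

theorem fsum_singleton' {S : Type*} [AddSemigroup S] (a : ℕ → S) (m : ℕ) :
    fsum a {m} = a m := by
  simp [fsum]

theorem fsum_insert_min {S : Type*} [AddSemigroup S] (a : ℕ → S) (m : ℕ) (F : Finset ℕ)
    (hF : F.Nonempty) (h : ∀ x ∈ F, m < x) : fsum a (insert m F) = a m + fsum a F := by
  have hs : (insert m F).sort (· ≤ ·) = m :: F.sort (· ≤ ·) :=
    Finset.sort_insert (· ≤ ·) (fun b hb => (h b hb).le) (fun hm => lt_irrefl _ (h m hm))
  unfold fsum
  rw [hs]
  cases hl : F.sort (· ≤ ·) with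
  | nil =>
    obtain ⟨x, hx⟩ := hF
    have : x ∈ F.sort (· ≤ ·) := by simpa using hx
    simp [hl] at this
  | cons x xs =>
    haveI : Std.Associative (α := S) (· + ·) := ⟨add_assoc⟩
    simp only [List.map_cons, List.foldl_cons]
    exact List.foldl_assoc (op := (· + · : S → S → S))

theorem fsum_insert_max {S : Type*} [AddSemigroup S] (a : ℕ → S) (m : ℕ) (F : Finset ℕ)
    (hF : F.Nonempty) (h : ∀ x ∈ F, x < m) : fsum a (insert m F) = fsum a F + a m := by
  induction F using Finset.induction_on_min with
  | empty => simp at hF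
  | insert x s hx ih =>
    have hxm : x < m := h x (by simp)
    rw [Finset.insert_comm]
    rcases s.eq_empty_or_nonempty with rfl | hs
    · rw [fsum_insert_min _ _ _ (by simp) (by simpa using hxm)]
      simp [fsum_singleton']
    · rw [fsum_insert_min _ _ _ (by simp), ih hs (fun y hy => h y (by simp [hy])),
        fsum_insert_min _ _ _ hs hx, add_assoc]
      intro y hy
      rcases Finset.mem_insert.1 hy with rfl | hy
      · exact hxm
      · exact hx y hy

theorem mt_exists_idem {S : Type*} [AddSemigroup S] (A : ℕ → Set S) (h : IsFreeIdemChain A) :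
    ∃ U : Ultrafilter S, U + U = U ∧ ∀ n, ∀ᶠ x in U, x ∈ A n := by
  obtain ⟨hinf, hdec, -, hstar⟩ := h
  let T : Set (Ultrafilter S) := ⋂ n, { U | ∀ᶠ m in U, m ∈ A n }
  have h := exists_idempotent_in_compact_add_subsemigroup ?_ T ?_ ?_ ?_
  · rcases h with ⟨U, hU, U_idem⟩
    exact ⟨U, U_idem, fun n => Set.mem_iInter.mp hU n⟩
  · exact Ultrafilter.continuous_add_left
  · apply IsCompact.nonempty_iInter_of_sequence_nonempty_isCompact_isClosed
    · intro n U hU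
      filter_upwards [hU]
      exact fun x hx => hdec n hx
    · intro n
      obtain ⟨x, hx⟩ := (hinf n).nonempty
      exact ⟨pure x, mem_pure.mpr hx⟩
    · exact (ultrafilter_isClosed_basic _).isCompact
    · intro n
      apply ultrafilter_isClosed_basic
  · exact IsClosed.isCompact (isClosed_iInter fun i => ultrafilter_isClosed_basic _)
  · intro U hU V hV
    rw [Set.mem_iInter] at *
    intro n
    rw [Set.mem_ofPred_eq, Ultrafilter.eventually_add]
    obtain ⟨m, hm⟩ := hstar n
    filter_upwards [hU m] with x hx
    obtain ⟨_, ⟨k, rfl⟩, hk⟩ := hm hx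
    filter_upwards [hV k] with y hy
    exact hk y hy

theorem exists_color {S : Type*} {k : ℕ} (U : Ultrafilter S) (χ : S → Fin k) :
    ∃ c, ∀ᶠ x in U, χ x = c := by
  obtain ⟨c, hc⟩ := Ultrafilter.eq_pure_of_finite (U.map χ)
  refine ⟨c, ?_⟩
  have : {c} ∈ U.map χ := by rw [hc]; exact Set.mem_singleton c
  exact this

structure MTState (S : Type*) where
  E : Set S
  P : Set S
  b : S
  F : Finset ℕ
  k : ℕ

def MTValid {S : Type*} [AddSemigroup S] (U : Ultrafilter S) (A : ℕ → Set S) (D : Set S)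
    (R : S → S → Prop) (s : MTState S) : Prop :=
  s.E ∈ U ∧ s.E ⊆ D ∧ s.E ⊆ A s.k ∧ s.P.Finite ∧
    (∀ x ∈ s.P, x ∈ D ∧ ∀ y ∈ s.E, x + y ∈ D) ∧ (∀ x ∈ s.P, ∀ y ∈ s.E, R x y)

def MTStep {S : Type*} [AddSemigroup S] (a : ℕ → S) (s t : MTState S) : Prop :=
  t.b ∈ s.E ∧ t.E ⊆ s.E ∧ (∀ y ∈ t.E, t.b + y ∈ s.E) ∧ s.P ⊆ t.P ∧ t.b ∈ t.P ∧
    (∀ x ∈ s.P, x + t.b ∈ t.P) ∧ s.k < t.k ∧ t.F.Nonempty ∧ (∀ i ∈ t.F, s.k ≤ i ∧ i < t.k) ∧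
    t.b = fsum a t.F

theorem mt_step {S : Type*} [AddSemigroup S] (a : ℕ → S) (U : Ultrafilter S) (hU : U + U = U)
    (A : ℕ → Set S) (hA : ∀ n, ∀ᶠ x in U, x ∈ A n) (hAFS : ∀ n, A n ⊆ FStail a n) (D : Set S)
    (R : S → S → Prop) (hD : ∀ x ∈ D, ∀ᶠ y in U, R x y) (s : MTState S)
    (hs : MTValid U A D R s) : ∃ t, MTValid U A D R t ∧ MTStep a s t := by
  obtain ⟨hE, hED, hEA, hP, hPD, hPR⟩ := hs
  have hE2 : ∀ᶠ x in U, ∀ᶠ y in U, x + y ∈ s.E := by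
    have h := hE
    rw [← hU] at h
    exact h
  obtain ⟨b, hbE, hb⟩ := ((show ∀ᶠ x in U, x ∈ s.E from hE).and hE2).exists
  obtain ⟨F, hF, hFk, hFb⟩ := hAFS _ (hEA hbE)
  let P' : Set S := insert b (s.P ∪ (fun x => x + b) '' s.P)
  have hP'fin : P'.Finite := (hP.union (hP.image _)).insert b
  have hP'D : ∀ x ∈ P', x ∈ D := by
    rintro x (rfl | hx | ⟨z, hz, rfl⟩)
    · exact hED hbE
    · exact (hPD x hx).1
    · exact (hPD z hz).2 b hbE
  let k' := max s.k (F.sup id) + 1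
  let E' : Set S := {y | y ∈ s.E ∧ b + y ∈ s.E ∧ y ∈ A k' ∧ ∀ x ∈ P', R x y}
  have hE' : ∀ᶠ y in U, y ∈ E' := by
    have h1 : ∀ᶠ y in U, ∀ x ∈ P', R x y :=
      (Filter.eventually_all_finite hP'fin).2 fun x hx => hD x (hP'D x hx)
    filter_upwards [hE, hb, hA k', h1] with y h1 h2 h3 h4
    exact ⟨h1, h2, h3, h4⟩
  refine ⟨⟨E', P', b, F, k'⟩, ⟨hE', fun y hy => hED hy.1, fun y hy => hy.2.2.1, hP'fin, ?_,
    fun x hx y hy => hy.2.2.2 x hx⟩, hbE, fun y hy => hy.1, fun y hy => hy.2.1, ?_, ?_, ?_, ?_,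
    hF, ?_, hFb.symm⟩
  · intro x hx
    refine ⟨hP'D x hx, fun y hy => ?_⟩
    rcases hx with rfl | hx | ⟨z, hz, rfl⟩
    · exact hED hy.2.1
    · exact (hPD x hx).2 y hy.1
    · simp only [add_assoc]
      exact (hPD z hz).2 _ hy.2.1
  · exact fun x hx => Or.inr (Or.inl hx)
  · exact Or.inl rfl
  · exact fun x hx => Or.inr (Or.inr ⟨x, hx, rfl⟩)
  · change s.k < max s.k (F.sup id) + 1
    omega
  · intro i hi
    refine ⟨hFk i hi, ?_⟩
    have : i ≤ F.sup id := Finset.le_sup (f := id) hi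
    change i < max s.k (F.sup id) + 1
    omega

/-- Let `a` be a sequence in a semigroup `S` and `A₀ ⊇ A₁ ⊇ ⋯` a free idempotent chain
with `Aₙ ⊆ FS(aₙ, aₙ₊₁, …)` for all `n`. Then for all finite colorings of `S` and of the
2-element subsets of `S`, there are `bₙ ∈ Aₙ` forming a proper sumsequence of `a` whose
set of finite sums and sum graph are both monochromatic. -/
theorem milliken_taylor_chain {S : Type*} [AddSemigroup S]
    (a : ℕ → S) (A : ℕ → Set S) (hchain : IsFreeIdemChain A)
    (hAFS : ∀ n, A n ⊆ FStail a n)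
    (k r : ℕ) (χ₁ : S → Fin k) (χ₂ : Sym2 S → Fin r) :
    ∃ b : ℕ → S, (∀ n, b n ∈ A n) ∧
      IsSumSeq a b ∧ IsProper b ∧
      (∃ c₁ : Fin k, ∀ s ∈ FSset b, χ₁ s = c₁) ∧
      (∃ c₂ : Fin r, ∀ F H : Finset ℕ, F.Nonempty → H.Nonempty → FinsetLT F H →
        χ₂ s(fsum b F, fsum b H) = c₂) := by
  obtain ⟨U, hU, hA⟩ := mt_exists_idem A hchain
  obtain ⟨-, hdec, hempty, -⟩ := hchain
  have hanti : Antitone A := antitone_nat_of_succ_le hdec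
  obtain ⟨c₁, hc₁⟩ := exists_color U χ₁
  choose f hf using fun x => exists_color U (fun y => χ₂ s(x, y))
  obtain ⟨c₂, hc₂⟩ := exists_color U f
  let R : S → S → Prop := fun x y => χ₂ s(x, y) = c₂ ∧ x ≠ y
  let D : Set S := {x | χ₁ x = c₁ ∧ f x = c₂}
  have hDU : ∀ᶠ x in U, x ∈ D := hc₁.and hc₂
  have hD : ∀ x ∈ D, ∀ᶠ y in U, R x y := by
    intro x hx
    have : ∃ n, x ∉ A n := by
      by_contra! hcon
      have : x ∈ ⋂ n, A n := Set.mem_iInter.2 hcon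
      rw [hempty] at this
      exact this
    obtain ⟨n, hn⟩ := this
    filter_upwards [hf x, hA n] with y hy hyn
    refine ⟨hy.trans hx.2, ?_⟩
    rintro rfl
    exact hn hyn
  have key : ∀ s : {s : MTState S // MTValid U A D R s},
      ∃ t : {s : MTState S // MTValid U A D R s}, MTStep a s.1 t.1 := by
    rintro ⟨s, hs⟩
    obtain ⟨t, ht, hst⟩ := mt_step a U hU A hA hAFS D R hD s hs
    exact ⟨⟨t, ht⟩, hst⟩
  choose g hg using key
  let s₀ : {s : MTState S // MTValid U A D R s} := ⟨⟨D ∩ A 0, ∅, a 0, ∅, 0⟩,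
    hDU.and (hA 0), Set.inter_subset_left, Set.inter_subset_right, Set.finite_empty,
    by simp, by simp⟩
  let q : ℕ → {s : MTState S // MTValid U A D R s} := fun n => g^[n] s₀
  have hq : ∀ n, MTStep a (q n).1 (q (n + 1)).1 := by
    intro n
    have : q (n + 1) = g (q n) := Function.iterate_succ_apply' g n s₀
    rw [this]
    exact hg _
  have hk : StrictMono fun n => (q n).1.k :=
    strictMono_nat_of_lt_succ fun n => (hq n).2.2.2.2.2.2.1
  have hEanti : Antitone fun n => (q n).1.E := antitone_nat_of_succ_le fun n => (hq n).2.1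
  have hPmono : Monotone fun n => (q n).1.P := monotone_nat_of_le_succ fun n => (hq n).2.2.2.1
  let b : ℕ → S := fun n => (q (n + 1)).1.b
  have hbE : ∀ n, b n ∈ (q n).1.E := fun n => (hq n).1
  have hEsum : ∀ F : Finset ℕ, F.Nonempty → ∀ n, (∀ i ∈ F, n ≤ i) → fsum b F ∈ (q n).1.E := by
    intro F
    induction F using Finset.induction_on_min with
    | empty => simp
    | insert m s hm ih =>
      intro _ n hn
      have hnm : n ≤ m := hn m (by simp)
      apply hEanti hnm
      rcases s.eq_empty_or_nonempty with rfl | hs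
      · simpa [fsum_singleton'] using hbE m
      · rw [fsum_insert_min _ _ _ hs hm]
        exact (hq m).2.2.1 _ (ih hs (m + 1) (fun i hi => hm i hi))
  have hPsum : ∀ F : Finset ℕ, F.Nonempty → ∀ n, (∀ i ∈ F, i < n) → fsum b F ∈ (q n).1.P := by
    intro F
    induction F using Finset.induction_on_max with
    | empty => simp
    | insert m s hm ih =>
      intro _ n hn
      have hnm : m + 1 ≤ n := hn m (by simp)
      apply hPmono hnm
      rcases s.eq_empty_or_nonempty with rfl | hs
      · simpa [fsum_singleton'] using (hq m).2.2.2.2.1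
      · rw [fsum_insert_max _ _ _ hs hm]
        exact (hq m).2.2.2.2.2.1 _ (ih hs m hm)
  have hR : ∀ F H : Finset ℕ, F.Nonempty → H.Nonempty → FinsetLT F H →
      R (fsum b F) (fsum b H) := by
    intro F H hF hH hFH
    have h1 := hPsum F hF (F.max' hF + 1) fun i hi => Nat.lt_succ_of_le (F.le_max' i hi)
    have h2 := hEsum H hH (F.max' hF + 1) fun j hj => hFH _ (F.max'_mem hF) j hj
    exact (q (F.max' hF + 1)).2.2.2.2.2.2 _ h1 _ h2
  refine ⟨b, fun n => ?_, ⟨fun n => (q (n + 1)).1.F, fun n => (hq n).2.2.2.2.2.2.2.1, ?_,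
    fun n => (hq n).2.2.2.2.2.2.2.2.2⟩, ?_, ⟨c₁, ?_⟩, ⟨c₂, ?_⟩⟩
  · exact hanti (hk.id_le n) ((q n).2.2.2.1 (hbE n))
  · intro n i hi j hj
    exact lt_of_lt_of_le ((hq n).2.2.2.2.2.2.2.2.1 i hi).2
      ((hq (n + 1)).2.2.2.2.2.2.2.2.1 j hj).1
  · exact fun F H hF hH hFH => (hR F H hF hH hFH).2
  · rintro s ⟨F, hF, rfl⟩
    exact ((q 0).2.2.1 (hEsum F hF 0 fun i _ => Nat.zero_le i)).1
  · exact fun F H hF hH hFH => (hR F H hF hH hFH).1
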